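/- Let l, r, s, t, u be nonnegative integers with l ≥ 1, r+s > 0, t+u > 0, r+t > 0, s+u > 0 and r+s+t+u ≤ l. Then the partition D(l) + Λ^{r+s−1} + Λ^{l−t−u+1} (a partition with three columns, of lengths l, l−t−u+1 and r+s−1) has positive multiplicity in the product of Schur functions s_{Λ^r+Λ^{l−t}} · s_{Λ^s+Λ^{l−u}}. -/

import Mathlib

open Finset MvPolynomial

/-- `hp l k` is the complete homogeneous symmetric polynomial `h_k` in `l` variables,
interpreted as `0` for negative `k` (and `h_0 = 1`). -/
noncomputable def hp (l : ℕ) (k : ℤ) : MvPolynomial (Fin l) ℤ :=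
  if 0 ≤ k then MvPolynomial.hsymm (Fin l) ℤ k.toNat else 0

/-- The Schur polynomial of a partition (given as a weakly decreasing `l`-tuple) in `l`
variables, defined by the Jacobi–Trudi determinant `s_A = det (h_{A i - i + j})`. -/
noncomputable def schur (l : ℕ) (A : Fin l → ℕ) : MvPolynomial (Fin l) ℤ :=
  Matrix.det (Matrix.of fun i j : Fin l => hp l ((A i : ℤ) + (j : ℕ) - (i : ℕ)))

/-- The Vandermonde alternant `a_δ = det (x_i ^ (l - 1 - j))`. -/
noncomputable def vdm (l : ℕ) : MvPolynomial (Fin l) ℤ :=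
  Matrix.det (Matrix.of fun i j : Fin l => (X i : MvPolynomial (Fin l) ℤ) ^ (l - 1 - (j : ℕ)))

/-- The multiplicity (coefficient) of the Schur polynomial `s_B` in the expansion of a
symmetric polynomial `P` in the basis of Schur polynomials of partitions of length at most
`l`: it equals the coefficient of the monomial `x ^ (B + δ)` in the alternating polynomial
`P * a_δ`, where `δ = (l-1, l-2, …, 0)`. -/
noncomputable def schurMult (l : ℕ) (B : Fin l → ℕ) (P : MvPolynomial (Fin l) ℤ) : ℤ :=
  MvPolynomial.coeff (Finsupp.equivFunOnFinite.symm fun i : Fin l => B i + (l - 1 - (i : ℕ)))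
    (P * vdm l)

/-- The Littlewood–Richardson coefficient `c^C_{A,B}` for partitions of length at most `l`,
as the multiplicity of `s_C` in `s_A * s_B` (this agrees with the structure constants of the
ring of symmetric functions in the Schur basis). -/
noncomputable def lrCoeff (l : ℕ) (A B C : Fin l → ℕ) : ℤ :=
  schurMult l C (schur l A * schur l B)

/-- Dominance: every partial sum of `A` is at least the corresponding partial sum of `B`. -/
def Dom (l : ℕ) (A B : Fin l → ℕ) : Prop :=
  ∀ r : ℕ, ∑ i ∈ Finset.univ.filter (fun i : Fin l => (i : ℕ) < r), B i ≤
    ∑ i ∈ Finset.univ.filter (fun i : Fin l => (i : ℕ) < r), A i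

/-- The Young diagram of `A` (0-based): boxes `(i, j)` with `j < A i`. -/
def YD (l : ℕ) (A : Fin l → ℕ) : Set (Fin l × ℕ) := {p | p.2 < A p.1}


/-- The alternant `a_α = det (x_i ^ α_j)`. -/
noncomputable def alt (l : ℕ) (α : Fin l → ℕ) : MvPolynomial (Fin l) ℤ :=
  Matrix.det (Matrix.of fun i j : Fin l => (X i : MvPolynomial (Fin l) ℤ) ^ (α j))

/-- Indicator function of a finset. -/
def ind {l : ℕ} (T : Finset (Fin l)) (i : Fin l) : ℕ := if i ∈ T then 1 else 0

theorem geom_mul (R : Type) [CommRing R] (a : R) :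
    (PowerSeries.mk fun n => a ^ n) * (1 - PowerSeries.C a * PowerSeries.X) = 1 := by
  ext n
  rw [mul_sub, mul_one, mul_comm (PowerSeries.C a), ← mul_assoc, map_sub]
  cases n with
  | zero => simp
  | succ n => simp [PowerSeries.coeff_succ_mul_X, PowerSeries.coeff_one, pow_succ]

theorem hsymm_gen (l : ℕ) :
    (PowerSeries.mk fun n => hsymm (Fin l) ℤ n) =
      ∏ i : Fin l, PowerSeries.mk fun n => (X i : MvPolynomial (Fin l) ℤ) ^ n := by
  ext1 n
  rw [PowerSeries.coeff_prod]
  simp only [PowerSeries.coeff_mk]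
  unfold hsymm
  rw [← Finset.sum_coe_sort (Finset.finsuppAntidiag univ n)]
  refine Fintype.sum_equiv ((Sym.equivNatSum (Fin l) n).trans
    (Equiv.subtypeEquivRight (fun P => ?_))) _ _ ?_
  · simp [Finsupp.sum_fintype]
  · intro s
    rw [Finset.prod_multiset_map_count]
    simp only [Equiv.trans_apply, Equiv.subtypeEquivRight_apply, Sym.coe_equivNatSum_apply_apply]
    refine Finset.prod_subset (Finset.subset_univ _) ?_
    intro x _ hx
    rw [Multiset.mem_toFinset] at hx
    have h0 := Multiset.count_eq_zero_of_notMem hx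
    convert pow_zero (X x : MvPolynomial (Fin l) ℤ)

/-- `∏_{m ≠ k} (1 - x_m z)`. -/
noncomputable def Qp (l : ℕ) (k : Fin l) : Polynomial (MvPolynomial (Fin l) ℤ) :=
  ∏ m ∈ univ.erase k, (1 - Polynomial.C (X m) * Polynomial.X)

theorem Qp_natDegree (l : ℕ) (k : Fin l) : (Qp l k).natDegree < l := by
  have hl : 0 < l := lt_of_le_of_lt (Nat.zero_le _) k.2
  have : (Qp l k).natDegree ≤ ∑ m ∈ univ.erase k, 1 := by
    refine (Polynomial.natDegree_prod_le _ _).trans (Finset.sum_le_sum fun m _ => ?_)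
    compute_degree
  simp at this
  omega

theorem hgen_mul_Qp (l : ℕ) (k : Fin l) :
    (PowerSeries.mk fun n => hsymm (Fin l) ℤ n) * ((Qp l k : Polynomial _) : PowerSeries _) =
      PowerSeries.mk fun n => (X k : MvPolynomial (Fin l) ℤ) ^ n := by
  rw [hsymm_gen, ← Finset.mul_prod_erase univ _ (Finset.mem_univ k), Qp]
  have : ((∏ m ∈ univ.erase k, (1 - Polynomial.C (X m) * Polynomial.X) :
      Polynomial (MvPolynomial (Fin l) ℤ)) : PowerSeries (MvPolynomial (Fin l) ℤ)) =
      ∏ m ∈ univ.erase k, (1 - PowerSeries.C (X m) * PowerSeries.X) := by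
    rw [← Polynomial.coeToPowerSeries.ringHom_apply, map_prod]
    simp
  rw [this, mul_assoc, ← Finset.prod_mul_distrib]
  simp only [geom_mul, Finset.prod_const_one, mul_one]

theorem hp_sum (l : ℕ) (k : Fin l) (a : ℕ) :
    ∑ j : Fin l, hp l ((a : ℤ) - ((l - 1 : ℕ) : ℤ) + (j : ℕ)) * (Qp l k).coeff (l - 1 - (j : ℕ)) =
      (X k : MvPolynomial (Fin l) ℤ) ^ a := by
  have h1 := congrArg (PowerSeries.coeff a) (hgen_mul_Qp l k)
  rw [PowerSeries.coeff_mul, PowerSeries.coeff_mk] at h1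
  rw [← h1]
  simp only [PowerSeries.coeff_mk, Polynomial.coeff_coe]
  rw [← Finset.Nat.sum_antidiagonal_swap, Finset.Nat.sum_antidiagonal_eq_sum_range_succ_mk]
  simp only [Prod.swap]
  have h2 : ∑ n ∈ range (a + 1), hsymm (Fin l) ℤ (a - n) * (Qp l k).coeff n =
      ∑ n ∈ range (a + 1 + l), hp l ((a : ℤ) - n) * (Qp l k).coeff n := by
    rw [Finset.sum_range_add _ (a + 1) l]
    rw [Finset.sum_eq_zero (s := range l), add_zero]
    · refine Finset.sum_congr rfl fun n hn => ?_
      rw [Finset.mem_range] at hn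
      rw [hp, if_pos (by omega)]
      congr 2
      omega
    · intro n _
      rw [hp, if_neg (by push_cast; omega), zero_mul]
  rw [h2, add_comm (a + 1) l, Finset.sum_range_add]
  rw [Finset.sum_eq_zero (s := range (a + 1)), add_zero]
  · rw [Finset.sum_range, ← Equiv.sum_comp Fin.revPerm]
    refine Finset.sum_congr rfl fun j _ => ?_
    have := j.2
    simp only [Fin.revPerm_apply, Fin.val_rev]
    congr 2 <;> omega
  · intro n _
    rw [Polynomial.coeff_eq_zero_of_natDegree_lt, mul_zero]
    have := Qp_natDegree l k
    omega

theorem schur_mul_det (l : ℕ) (A : Fin l → ℕ) :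
    schur l A * Matrix.det (Matrix.of fun j k : Fin l => (Qp l k).coeff (l - 1 - (j : ℕ))) =
      alt l (fun i => A i + (l - 1 - (i : ℕ))) := by
  rw [schur, alt, ← Matrix.det_mul, ← Matrix.det_transpose]
  congr 1
  ext1 i k
  rw [Matrix.transpose_apply, Matrix.mul_apply]
  simp only [Matrix.of_apply]
  rw [← hp_sum]
  refine Finset.sum_congr rfl fun j _ => ?_
  congr 2
  have := k.2
  push_cast [show (k : ℕ) ≤ l - 1 by omega, show 1 ≤ l by omega]
  ring

theorem schur_zero (l : ℕ) : schur l (fun _ => 0) = 1 := by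
  rw [schur, Matrix.det_of_isUpperTriangular]
  · simp [hp]
  · intro i j hij
    have : (j : ℕ) < i := hij
    simp only [Matrix.of_apply, hp]
    rw [if_neg (by push_cast; omega)]

theorem vdm_eq (l : ℕ) : vdm l = alt l (fun i => l - 1 - (i : ℕ)) := rfl

theorem bialt (l : ℕ) (A : Fin l → ℕ) :
    schur l A * vdm l = alt l (fun i => A i + (l - 1 - (i : ℕ))) := by
  have h := schur_mul_det l (fun _ => 0)
  rw [schur_zero, one_mul] at h
  rw [← schur_mul_det, h, vdm_eq]
  simp

theorem alt_eq_zero (l : ℕ) (α : Fin l → ℕ) {i j : Fin l} (hij : i ≠ j) (h : α i = α j) :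
    alt l α = 0 := by
  unfold alt
  exact Matrix.det_zero_of_column_eq hij (fun k => by simp [h])

theorem alt_expand (l : ℕ) (α : Fin l → ℕ) :
    alt l α = ∑ σ : Equiv.Perm (Fin l), (Equiv.Perm.sign σ : ℤ) •
      ∏ i, (X (σ i) : MvPolynomial (Fin l) ℤ) ^ α i := by
  rw [alt, Matrix.det_apply]
  rfl

theorem coeff_alt (l : ℕ) (α γ : Fin l → ℕ) (hα : StrictAnti α) (hγ : StrictAnti γ) :
    coeff (Finsupp.equivFunOnFinite.symm γ) (alt l α) = if α = γ then 1 else 0 := by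
  have key : ∀ σ : Equiv.Perm (Fin l), coeff (Finsupp.equivFunOnFinite.symm γ)
      (∏ i, (X (σ i) : MvPolynomial (Fin l) ℤ) ^ α i) =
        if (∀ i, α i = γ (σ i)) then 1 else 0 := by
    intro σ
    have : (∏ i, (X (σ i) : MvPolynomial (Fin l) ℤ) ^ α i) =
        ∏ i, (X i : MvPolynomial (Fin l) ℤ) ^ α (σ.symm i) := by
      rw [← Equiv.prod_comp σ (fun i => (X i : MvPolynomial (Fin l) ℤ) ^ α (σ.symm i))]; simp
    rw [this]
    have h2 : (∏ i, (X i : MvPolynomial (Fin l) ℤ) ^ α (σ.symm i)) =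
        monomial (Finsupp.equivFunOnFinite.symm (fun i => α (σ.symm i))) 1 := by
      rw [monomial_eq, map_one, one_mul, Finsupp.prod_fintype _ _ (by simp)]
      rfl
    rw [h2, coeff_monomial]
    congr 1
    rw [Equiv.apply_eq_iff_eq, _root_.funext_iff]
    apply propext
    constructor
    · intro h i; simpa using h (σ i)
    · intro h i; simpa using h (σ.symm i)
  rw [alt_expand, coeff_sum]
  simp only [coeff_smul, key]
  rw [Finset.sum_eq_single 1]
  · by_cases h : α = γ
    · simp [h]
    · rw [if_neg h, if_neg (fun h' : ∀ i, α i = γ ((1 : Equiv.Perm (Fin l)) i) => h (funext h')), smul_zero]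
  · intro σ _ hσ
    rw [if_neg, smul_zero]
    intro h
    apply hσ
    have hm : StrictMono σ := by
      intro i j hij
      have := hα hij
      rw [h, h] at this
      exact hγ.lt_iff_gt.1 this
    ext i
    have hid : (⇑σ) = id := by
      have h1 := Subsingleton.elim (hm.orderIsoOfSurjective σ σ.surjective) (OrderIso.refl _)
      ext i
      have := congrArg (fun f => (f i : Fin l)) h1
      simpa using congrArg Fin.val this
    simp [hid]
  · simp

theorem pieri (l : ℕ) (α : Fin l → ℕ) (k : ℕ) :
    esymm (Fin l) ℤ k * alt l α = ∑ T ∈ powersetCard k univ, alt l (α + ind T) := by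
  simp only [alt_expand]
  rw [Finset.sum_comm, Finset.mul_sum]
  refine Finset.sum_congr rfl fun σ _ => ?_
  rw [mul_smul_comm, ← Finset.smul_sum]
  congr 1
  have : esymm (Fin l) ℤ k = ∑ T ∈ powersetCard k univ, ∏ i ∈ T, X (σ i) := by
    rw [← rename_esymm (Fin l) ℤ k σ, esymm, map_sum]
    simp [map_prod]
  rw [this, Finset.sum_mul]
  refine Finset.sum_congr rfl fun T _ => ?_
  simp only [Pi.add_apply, pow_add, Finset.prod_mul_distrib, ind]
  rw [mul_comm]
  congr 1
  simp [Finset.prod_ite_mem, pow_ite]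

/-- The column `Λ^m`. -/
def col (l m : ℕ) (i : Fin l) : ℕ := if (i : ℕ) < m then 1 else 0

/-- The staircase. -/
def dl (l : ℕ) (i : Fin l) : ℕ := l - 1 - (i : ℕ)

theorem sum_ind {l : ℕ} (T : Finset (Fin l)) : ∑ i, ind T i = T.card := by
  simp [ind]

theorem sum_col {l m : ℕ} (h : m ≤ l) : ∑ i, col l m i = m := by
  simp only [col, Finset.sum_boole, Nat.cast_id]
  rw [Fin.card_filter_val_lt]
  omega

theorem initial_of {l b : ℕ} (T : Finset (Fin l)) (hT : T.card = b)
    (h : ∀ i j : Fin l, (j : ℕ) = i + 1 → j ∈ T → i ∈ T) :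
    T = univ.filter (fun i : Fin l => (i : ℕ) < b) := by
  have low : ∀ n : ℕ, ∀ i j : Fin l, (j : ℕ) = i + n → j ∈ T → i ∈ T := by
    intro n
    induction n with
    | zero =>
      intro i j hij hj
      have : i = j := Fin.ext (by omega)
      rwa [this]
    | succ n ih =>
      intro i j hij hj
      have hjl := j.2
      exact ih i ⟨i + n, by omega⟩ rfl (h _ j (by simp; omega) hj)
  ext x
  simp only [Finset.mem_filter, Finset.mem_univ, true_and]
  constructor
  · intro hx
    have : Finset.Iic x ⊆ T := by
      intro y hy
      rw [Finset.mem_Iic] at hy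
      exact low (x - y) y x (by have : (y : ℕ) ≤ x := hy; omega) hx
    have := Finset.card_le_card this
    rw [Fin.card_Iic] at this
    omega
  · intro hx
    by_contra hxT
    have : T ⊆ Finset.Iio x := by
      intro y hy
      rw [Finset.mem_Iio]
      by_contra hyx
      exact hxT (low (y - x) x y (by have : (x : ℕ) ≤ y := not_lt.1 hyx; omega) hy)
    have := Finset.card_le_card this
    rw [Fin.card_Iio] at this
    omega

theorem alt_van {l a b : ℕ} (T : Finset (Fin l)) (hT : T.card = b)
    (ha : ∀ i ∈ T, (i : ℕ) ≠ a)
    (hne : T ≠ univ.filter (fun i : Fin l => (i : ℕ) < b)) :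
    alt l (dl l + col l a + ind T) = 0 := by
  by_contra hc
  apply hne
  apply initial_of T hT
  intro i j hij hj
  by_contra hi
  apply hc
  have := ha j hj
  refine alt_eq_zero l _ (i := i) (j := j) (fun h => by rw [h] at hij; omega) ?_
  have := j.2
  simp only [Pi.add_apply, dl, col, ind, if_pos hj, if_neg hi]
  split_ifs <;> omega

theorem ind_initial (l b : ℕ) : ind (univ.filter (fun i : Fin l => (i : ℕ) < b)) = col l b := by
  ext i
  simp [ind, col]

theorem card_initial {l b : ℕ} (h : b ≤ l) :
    (univ.filter (fun i : Fin l => (i : ℕ) < b)).card = b := by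
  rw [Fin.card_filter_val_lt]
  omega

theorem col_zero (l : ℕ) : col l 0 = 0 := by
  ext i; simp [col]

theorem e_alt1 {l a : ℕ} (h : a ≤ l) :
    esymm (Fin l) ℤ a * alt l (dl l) = alt l (dl l + col l a) := by
  rw [pieri, Finset.sum_eq_single (univ.filter (fun i : Fin l => (i : ℕ) < a)), ind_initial]
  · intro T hT hne
    rw [Finset.mem_powersetCard] at hT
    by_contra hc
    apply hne
    apply initial_of T hT.2
    intro i j hij hj
    by_contra hi
    apply hc
    refine alt_eq_zero l _ (i := i) (j := j) (fun h => by rw [h] at hij; omega) ?_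
    have := j.2
    simp only [Pi.add_apply, dl, ind, if_pos hj, if_neg hi]
    omega
  · intro hn
    exact absurd (Finset.mem_powersetCard.2 ⟨Finset.subset_univ _, card_initial h⟩) hn

theorem e_alt2 {l a b : ℕ} (ha : a < l) (hb : b + 1 ≤ a) :
    esymm (Fin l) ℤ (b + 1) * alt l (dl l + col l a) -
      esymm (Fin l) ℤ b * alt l (dl l + col l (a + 1)) =
      alt l (dl l + col l a + col l (b + 1)) := by
  let k : Fin l := ⟨a, ha⟩
  rw [pieri, pieri]
  rw [← Finset.sum_filter_add_sum_filter_not (powersetCard (b + 1) univ) (fun T => k ∈ T)]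
  rw [← Finset.sum_filter_add_sum_filter_not (powersetCard b univ) (fun T => k ∈ T)]
  have h1 : ∑ T ∈ (powersetCard (b + 1) (univ : Finset (Fin l))).filter (fun T => k ∈ T),
        alt l (dl l + col l a + ind T) =
      ∑ T ∈ (powersetCard b (univ : Finset (Fin l))).filter (fun T => ¬ k ∈ T),
        alt l (dl l + col l (a + 1) + ind T) := by
    refine Finset.sum_nbij' (fun T => T.erase k) (fun T => insert k T) ?_ ?_ ?_ ?_ ?_
    · intro T hT
      simp only [Finset.mem_filter, Finset.mem_powersetCard] at hT ⊢
      refine ⟨⟨Finset.subset_univ _, ?_⟩, by simp⟩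
      rw [Finset.card_erase_of_mem hT.2, hT.1.2]; rfl
    · intro T hT
      simp only [Finset.mem_filter, Finset.mem_powersetCard] at hT ⊢
      refine ⟨⟨Finset.subset_univ _, ?_⟩, by simp⟩
      rw [Finset.card_insert_of_notMem hT.2, hT.1.2]
    · intro T hT
      simp only [Finset.mem_filter] at hT
      exact Finset.insert_erase hT.2
    · intro T hT
      simp only [Finset.mem_filter] at hT
      exact Finset.erase_insert hT.2
    · intro T hT
      simp only [Finset.mem_filter] at hT
      congr 1
      ext i
      simp only [Pi.add_apply, add_assoc]
      congr 1
      by_cases hi : i = k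
      · subst hi
        simp [col, ind, hT.2, k]
      · have : (i : ℕ) ≠ a := fun h => hi (Fin.ext h)
        have h2 : (i : ℕ) < a + 1 ↔ (i : ℕ) < a := by omega
        simp [col, ind, hi, h2]
  have h2 : ∑ T ∈ (powersetCard b (univ : Finset (Fin l))).filter (fun T => k ∈ T),
        alt l (dl l + col l (a + 1) + ind T) = 0 := by
    refine Finset.sum_eq_zero fun T hT => ?_
    simp only [Finset.mem_filter, Finset.mem_powersetCard] at hT
    obtain ⟨⟨_, hc⟩, hk⟩ := hT
    by_contra hne
    have low : ∀ n : ℕ, ∀ i : Fin l, (i : ℕ) + n = a → i ∈ T := by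
      intro n
      induction n with
      | zero =>
        intro i hi
        have : i = k := Fin.ext (by simpa using hi)
        rwa [this]
      | succ n ih =>
        intro i hi
        by_contra hiT
        have hj := ih ⟨i + 1, by omega⟩ (by simp; omega)
        apply hne
        refine alt_eq_zero l _ (i := i) (j := ⟨i + 1, by omega⟩)
          (fun h => by have := congrArg Fin.val h; simp at this) ?_
        simp only [Pi.add_apply, dl, col, ind, if_pos hj, if_neg hiT]
        rw [if_pos (by omega), if_pos (by omega)]
        omega
    have : Finset.Iic k ⊆ T := by
      intro y hy
      rw [Finset.mem_Iic] at hy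
      exact low (a - y) y (by have : (y : ℕ) ≤ a := hy; omega)
    have := Finset.card_le_card this
    rw [Fin.card_Iic] at this
    simp only [k] at this
    omega
  rw [h1, h2, zero_add, add_sub_cancel_left,
    Finset.sum_eq_single (univ.filter (fun i : Fin l => (i : ℕ) < b + 1)), ind_initial]
  · intro T hT hne
    simp only [Finset.mem_filter, Finset.mem_powersetCard] at hT
    refine alt_van T hT.1.2 ?_ hne
    intro i hi h
    exact hT.2 (by rwa [show k = i from Fin.ext h.symm])
  · intro hn
    refine absurd ?_ hn
    simp only [Finset.mem_filter, Finset.mem_powersetCard]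
    refine ⟨⟨Finset.subset_univ _, card_initial (by omega)⟩, ?_⟩
    simp [k]
    omega

theorem e_full (l : ℕ) (α : Fin l → ℕ) :
    esymm (Fin l) ℤ l * alt l α = alt l (α + fun _ => 1) := by
  have : powersetCard l (univ : Finset (Fin l)) = {univ} := by
    simpa using Finset.powersetCard_self (univ : Finset (Fin l))
  rw [pieri, this, Finset.sum_singleton]
  congr 1
  ext i
  simp [ind]

theorem dl_strict (l : ℕ) : StrictAnti (dl l) := by
  intro i j hij
  have h : (i : ℕ) < j := hij
  have := j.2
  simp only [dl]
  omega

theorem vdm_ne_zero (l : ℕ) : vdm l ≠ 0 := by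
  intro h
  have := coeff_alt l (dl l) (dl l) (dl_strict l) (dl_strict l)
  change coeff _ (vdm l) = _ at this
  rw [h] at this
  simp at this

theorem bialt' (l : ℕ) (A : Fin l → ℕ) : schur l A * vdm l = alt l (dl l + A) := by
  rw [bialt]
  congr 1
  ext i
  simp [dl, add_comm]

theorem schur_two {l a b : ℕ} (ha : a < l) (hb : b + 1 ≤ a) :
    schur l (col l a + col l (b + 1)) =
      esymm (Fin l) ℤ a * esymm (Fin l) ℤ (b + 1) -
        esymm (Fin l) ℤ (a + 1) * esymm (Fin l) ℤ b := by
  apply mul_right_cancel₀ (vdm_ne_zero l)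
  rw [bialt', ← add_assoc, ← e_alt2 ha hb, ← e_alt1 ha.le, ← e_alt1 (show a + 1 ≤ l from ha)]
  change _ = _ * alt l (dl l)
  ring

theorem schur_one {l a : ℕ} (ha : a ≤ l) : schur l (col l a) = esymm (Fin l) ℤ a := by
  apply mul_right_cancel₀ (vdm_ne_zero l)
  rw [bialt', ← e_alt1 ha]
  rfl

theorem schur_full {l b : ℕ} (hb : b ≤ l) :
    schur l (col l l + col l b) = esymm (Fin l) ℤ b * esymm (Fin l) ℤ l := by
  apply mul_right_cancel₀ (vdm_ne_zero l)
  rw [bialt', mul_comm (esymm (Fin l) ℤ b), mul_assoc]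
  change _ = _ * (_ * alt l (dl l))
  rw [e_alt1 hb, e_full]
  congr 1
  ext i
  simp [col]
  ring

theorem ind_le {l : ℕ} (T : Finset (Fin l)) (i : Fin l) : ind T i ≤ 1 := by
  unfold ind; split_ifs <;> simp

theorem anti_add {l : ℕ} {β : Fin l → ℕ} (hβ : StrictAnti β) (T : Finset (Fin l)) :
    Antitone (β + ind T) := by
  intro i j hij
  rcases hij.eq_or_lt with rfl | h
  · exact le_rfl
  · have := hβ h
    have h1 := ind_le T j
    simp only [Pi.add_apply]
    omega

theorem coeff_step {l : ℕ} {β γ : Fin l → ℕ} (hβ : StrictAnti β) (hγ : StrictAnti γ)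
    (T : Finset (Fin l)) :
    coeff (Finsupp.equivFunOnFinite.symm γ) (alt l (β + ind T)) =
      if β + ind T = γ then 1 else 0 := by
  by_cases hi : Function.Injective (β + ind T)
  · exact coeff_alt l _ _ ((anti_add hβ T).strictAnti_of_injective hi) hγ
  · rw [if_neg (fun h : β + ind T = γ => hi (by rw [h]; exact hγ.injective))]
    simp only [Function.Injective, not_forall] at hi
    obtain ⟨i, j, h, hne⟩ := hi
    rw [alt_eq_zero l _ hne h, coeff_zero]

theorem coeff_one_e {l : ℕ} {β γ : Fin l → ℕ} (hβ : StrictAnti β) (hγ : StrictAnti γ) (k : ℕ) :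
    coeff (Finsupp.equivFunOnFinite.symm γ) (esymm (Fin l) ℤ k * alt l β) =
      ∑ T ∈ powersetCard k univ, if β + ind T = γ then 1 else 0 := by
  rw [pieri, coeff_sum]
  exact Finset.sum_congr rfl fun T _ => coeff_step hβ hγ T

theorem ind_inj {l : ℕ} {S T : Finset (Fin l)} (h : ind S = ind T) : S = T := by
  ext i
  have := congrFun h i
  simp only [ind] at this
  split_ifs at this <;> simp_all

theorem cnt_nonneg {l : ℕ} (β γ : Fin l → ℕ) (k : ℕ) :
    (0 : ℤ) ≤ ∑ T ∈ powersetCard k (univ : Finset (Fin l)), if β + ind T = γ then 1 else 0 :=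
  Finset.sum_nonneg fun T _ => by split_ifs <;> simp

theorem cnt_pos {l : ℕ} {β γ : Fin l → ℕ} {k : ℕ} {S : Finset (Fin l)} (hS : S.card = k)
    (h : β + ind S = γ) :
    (1 : ℤ) ≤ ∑ T ∈ powersetCard k (univ : Finset (Fin l)), if β + ind T = γ then 1 else 0 := by
  have := Finset.single_le_sum
    (f := fun T => if β + ind T = γ then (1 : ℤ) else 0) (s := powersetCard k univ)
    (fun T _ => by split_ifs <;> simp) (Finset.mem_powersetCard.2 ⟨Finset.subset_univ S, hS⟩)
  simpa [h] using this

theorem cnt_le {l : ℕ} (β γ : Fin l → ℕ) (k : ℕ) :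
    (∑ T ∈ powersetCard k (univ : Finset (Fin l)), if β + ind T = γ then (1 : ℤ) else 0) ≤ 1 := by
  by_cases h : ∃ S, β + ind S = γ
  · obtain ⟨S, hS⟩ := h
    calc _ ≤ ∑ T ∈ powersetCard k (univ : Finset (Fin l)), if T = S then (1 : ℤ) else 0 := by
          refine Finset.sum_le_sum fun T _ => ?_
          by_cases hT : β + ind T = γ
          · have : T = S := ind_inj (add_left_cancel (hT.trans hS.symm))
            simp [this, hS]
          · rw [if_neg hT]; split_ifs <;> simp
      _ ≤ 1 := by rw [Finset.sum_ite_eq']; split_ifs <;> simp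
  · rw [Finset.sum_eq_zero]
    · simp
    · intro T _
      rw [if_neg (fun hT => h ⟨T, hT⟩)]

/-- The summand in the two-step Pieri rule. -/
noncomputable def gg (l a : ℕ) (β γ : Fin l → ℕ) (T : Finset (Fin l)) : ℤ :=
  coeff (Finsupp.equivFunOnFinite.symm γ) (esymm (Fin l) ℤ a * alt l (β + ind T))

theorem coeff_two_e {l : ℕ} (β γ : Fin l → ℕ) (a b : ℕ) :
    coeff (Finsupp.equivFunOnFinite.symm γ)
      (esymm (Fin l) ℤ a * esymm (Fin l) ℤ b * alt l β) =
      ∑ T ∈ powersetCard b univ, gg l a β γ T := by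
  rw [mul_assoc, pieri, Finset.mul_sum, coeff_sum]
  rfl

theorem gg_not_inj {l a : ℕ} {β γ : Fin l → ℕ} {T : Finset (Fin l)}
    (hi : ¬ Function.Injective (β + ind T)) : gg l a β γ T = 0 := by
  simp only [Function.Injective, not_forall] at hi
  obtain ⟨i, j, h, hne⟩ := hi
  rw [gg, alt_eq_zero l _ hne h, mul_zero, coeff_zero]

theorem gg_strict {l : ℕ} {a : ℕ} {β γ : Fin l → ℕ} {T : Finset (Fin l)} (hγ : StrictAnti γ)
    (hs : StrictAnti (β + ind T)) :
    gg l a β γ T = ∑ S ∈ powersetCard a univ, if β + ind T + ind S = γ then 1 else 0 :=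
  coeff_one_e hs hγ a

theorem gg_cases {l : ℕ} (a : ℕ) {β γ : Fin l → ℕ} (hβ : StrictAnti β) (hγ : StrictAnti γ)
    (T : Finset (Fin l)) :
    0 ≤ gg l a β γ T ∧ gg l a β γ T ≤ 1 ∧
      (gg l a β γ T ≠ 0 → ∃ S, β + ind T + ind S = γ) := by
  by_cases hi : Function.Injective (β + ind T)
  · have hs := (anti_add hβ T).strictAnti_of_injective hi
    rw [gg_strict hγ hs]
    refine ⟨cnt_nonneg _ _ _, cnt_le _ _ _, fun h => ?_⟩
    by_contra hc
    apply h
    refine Finset.sum_eq_zero fun S _ => ?_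
    rw [if_neg (fun hT => hc ⟨S, hT⟩)]
  · rw [gg_not_inj hi]; simp

theorem exS {l a : ℕ} {β γ : Fin l → ℕ}
    (h : ∀ i, β i ≤ γ i ∧ γ i ≤ β i + 1) (hs : ∑ i, γ i = ∑ i, β i + a) :
    ∃ S : Finset (Fin l), S.card = a ∧ β + ind S = γ := by
  have h1 : β + ind (univ.filter fun i => γ i = β i + 1) = γ := by
    ext i
    have := h i
    simp only [Pi.add_apply, ind, Finset.mem_filter, Finset.mem_univ, true_and]
    split_ifs <;> omega
  refine ⟨_, ?_, h1⟩
  rw [← sum_ind]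
  have h2 := congrArg (fun f => ∑ i, f i) h1
  simp only [Pi.add_apply, Finset.sum_add_distrib] at h2
  omega

theorem strict_of_anti {l : ℕ} {B : Fin l → ℕ}
    (h : ∀ i j : Fin l, (i : ℕ) < j → B j ≤ B i) : StrictAnti (dl l + B) := by
  intro i j hij
  have h1 := dl_strict l hij
  have h2 := h i j hij
  simp only [Pi.add_apply]
  omega

/-- The target partition. -/
def CC (l r s t u : ℕ) : Fin l → ℕ :=
  col l l + col l (l - t - u + 1) + col l (r + s - 1)

theorem CC_strict (l r s t u : ℕ) : StrictAnti (dl l + CC l r s t u) := by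
  apply strict_of_anti
  intro i j h
  have := j.2
  simp only [CC, col, Pi.add_apply]
  split_ifs <;> omega

theorem BB_strict (l s u : ℕ) : StrictAnti (dl l + (col l (l - u) + col l s)) := by
  apply strict_of_anti
  intro i j h
  have := j.2
  simp only [col, Pi.add_apply]
  split_ifs <;> omega

theorem sum_CC {l r s t u : ℕ} (h₁ : 0 < r + s) (h₂ : 0 < t + u) (h₅ : r + s + t + u ≤ l) :
    ∑ i, (dl l + CC l r s t u) i = ∑ i, dl l i + l + (l - t - u + 1) + (r + s - 1) := by
  simp only [CC, Pi.add_apply, Finset.sum_add_distrib]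
  rw [sum_col le_rfl, sum_col (by omega), sum_col (by omega)]
  omega

theorem sum_BB {l s u : ℕ} (h₅ : s + u ≤ l) :
    ∑ i, (dl l + (col l (l - u) + col l s)) i = ∑ i, dl l i + (l - u) + s := by
  simp only [Pi.add_apply, Finset.sum_add_distrib]
  rw [sum_col (by omega), sum_col (by omega)]
  omega

/-- Each admissible intermediate partition contributes. -/
theorem gg_pos {l r s t u : ℕ} (h₂ : 0 < t + u) (hr : 0 < r)
    (h₅ : r + s + t + u ≤ l) (T : Finset (Fin l)) (hT : T.card = r)
    (hanti : ∀ i j : Fin l, (i : ℕ) < j →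
      (col l (l - u) + col l s + ind T) j ≤ (col l (l - u) + col l s + ind T) i)
    (hle : ∀ i, (col l (l - u) + col l s + ind T) i ≤ CC l r s t u i ∧
      CC l r s t u i ≤ (col l (l - u) + col l s + ind T) i + 1) :
    1 ≤ gg l (l - t) (dl l + (col l (l - u) + col l s)) (dl l + CC l r s t u) T := by
  have hs := strict_of_anti hanti
  rw [← add_assoc] at hs
  rw [gg_strict (CC_strict l r s t u) hs]
  obtain ⟨S, hS, hS'⟩ := exS (l := l) (a := l - t)
    (β := dl l + (col l (l - u) + col l s) + ind T) (γ := dl l + CC l r s t u)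
    (by
      intro i
      have := hle i
      simp only [Pi.add_apply] at this ⊢
      omega)
    (by
      rw [sum_CC (by omega) h₂ h₅]
      have h1 : ∑ i, (dl l + (col l (l - u) + col l s) + ind T) i =
          ∑ i, (dl l + (col l (l - u) + col l s)) i + ∑ i, ind T i := by
        rw [← Finset.sum_add_distrib]; rfl
      rw [h1, sum_BB (by omega), sum_ind]
      omega)
  exact cnt_pos hS hS'

/-- `[s, r+s)` -/
theorem gg_T1 {l r s t u : ℕ} (h₂ : 0 < t + u) (hr : 0 < r) (ht : 0 < t)
    (h₅ : r + s + t + u ≤ l) :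
    ∃ T : Finset (Fin l), T.card = r ∧
      (∀ i : Fin l, i ∈ T ↔ s ≤ (i : ℕ) ∧ (i : ℕ) < r + s) ∧
      1 ≤ gg l (l - t) (dl l + (col l (l - u) + col l s)) (dl l + CC l r s t u) T := by
  let T : Finset (Fin l) := univ.filter (fun i => s ≤ (i : ℕ) ∧ (i : ℕ) < r + s)
  have hm : ∀ i : Fin l, i ∈ T ↔ s ≤ (i : ℕ) ∧ (i : ℕ) < r + s := by intro i; simp [T]
  have hc : T.card = r := by
    have h : ∑ i, (ind T i + col l s i) = ∑ i, col l (r + s) i := by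
      refine Finset.sum_congr rfl fun i _ => ?_
      simp only [ind, col, hm]
      split_ifs <;> omega
    rw [Finset.sum_add_distrib, sum_ind, sum_col (by omega), sum_col (by omega)] at h
    omega
  refine ⟨T, hc, hm, gg_pos h₂ hr h₅ T hc ?_ ?_⟩
  · intro i j hij
    simp only [Pi.add_apply, col, ind, hm]
    split_ifs <;> omega
  · intro i
    have := i.2
    simp only [Pi.add_apply, CC, col, ind, hm]
    constructor <;> split_ifs <;> omega

/-- `{0} ∪ [s, r+s-1)` -/
theorem gg_T2 {l r s t u : ℕ} (h₂ : 0 < t + u) (hr : 0 < r) (ht : 0 < t) (hs : 0 < s)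
    (h₅ : r + s + t + u ≤ l) :
    ∃ T : Finset (Fin l), T.card = r ∧
      (∀ i : Fin l, i ∈ T ↔ (i : ℕ) = 0 ∨ s ≤ (i : ℕ) ∧ (i : ℕ) < r + s - 1) ∧
      1 ≤ gg l (l - t) (dl l + (col l (l - u) + col l s)) (dl l + CC l r s t u) T := by
  let T : Finset (Fin l) := univ.filter
    (fun i => (i : ℕ) = 0 ∨ s ≤ (i : ℕ) ∧ (i : ℕ) < r + s - 1)
  have hm : ∀ i : Fin l, i ∈ T ↔ (i : ℕ) = 0 ∨ s ≤ (i : ℕ) ∧ (i : ℕ) < r + s - 1 := by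
    intro i; simp [T]
  have hc : T.card = r := by
    have h : ∑ i, (ind T i + col l s i) = ∑ i, (col l 1 i + col l (r + s - 1) i) := by
      refine Finset.sum_congr rfl fun i _ => ?_
      simp only [ind, col, hm]
      split_ifs <;> omega
    rw [Finset.sum_add_distrib, Finset.sum_add_distrib, sum_ind, sum_col (by omega),
      sum_col (by omega), sum_col (by omega)] at h
    omega
  refine ⟨T, hc, hm, gg_pos h₂ hr h₅ T hc ?_ ?_⟩
  · intro i j hij
    simp only [Pi.add_apply, col, ind, hm]
    split_ifs <;> omega
  · intro i
    have := i.2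
    simp only [Pi.add_apply, CC, col, ind, hm]
    constructor <;> split_ifs <;> omega

/-- `[s, r+s-1) ∪ {l-u}` -/
theorem gg_T3 {l r s t u : ℕ} (h₂ : 0 < t + u) (hr : 0 < r) (ht : 0 < t) (hu : 0 < u)
    (h₅ : r + s + t + u ≤ l) :
    ∃ T : Finset (Fin l), T.card = r ∧
      (∀ i : Fin l, i ∈ T ↔ (i : ℕ) = l - u ∨ s ≤ (i : ℕ) ∧ (i : ℕ) < r + s - 1) ∧
      1 ≤ gg l (l - t) (dl l + (col l (l - u) + col l s)) (dl l + CC l r s t u) T := by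
  let T : Finset (Fin l) := univ.filter
    (fun i => (i : ℕ) = l - u ∨ s ≤ (i : ℕ) ∧ (i : ℕ) < r + s - 1)
  have hm : ∀ i : Fin l, i ∈ T ↔ (i : ℕ) = l - u ∨ s ≤ (i : ℕ) ∧ (i : ℕ) < r + s - 1 := by
    intro i; simp [T]
  have hc : T.card = r := by
    have h : ∑ i, (ind T i + col l s i + col l (l - u) i) =
        ∑ i, (col l (l - u + 1) i + col l (r + s - 1) i) := by
      refine Finset.sum_congr rfl fun i _ => ?_
      simp only [ind, col, hm]
      split_ifs <;> omega
    rw [Finset.sum_add_distrib, Finset.sum_add_distrib, Finset.sum_add_distrib, sum_ind,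
      sum_col (by omega), sum_col (by omega), sum_col (by omega), sum_col (by omega)] at h
    omega
  refine ⟨T, hc, hm, gg_pos h₂ hr h₅ T hc ?_ ?_⟩
  · intro i j hij
    simp only [Pi.add_apply, col, ind, hm]
    split_ifs <;> omega
  · intro i
    have := i.2
    simp only [Pi.add_apply, CC, col, ind, hm]
    constructor <;> split_ifs <;> omega

theorem first_ge {l r s t u : ℕ} (hr : 0 < r) (ht : 0 < t) (h₄ : 0 < s + u)
    (h₅ : r + s + t + u ≤ l) :
    2 ≤ ∑ T ∈ powersetCard r univ,
      gg l (l - t) (dl l + (col l (l - u) + col l s)) (dl l + CC l r s t u) T := by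
  have key : ∀ T T' : Finset (Fin l), T ≠ T' → T.card = r → T'.card = r →
      1 ≤ gg l (l - t) (dl l + (col l (l - u) + col l s)) (dl l + CC l r s t u) T →
      1 ≤ gg l (l - t) (dl l + (col l (l - u) + col l s)) (dl l + CC l r s t u) T' →
      2 ≤ ∑ T ∈ powersetCard r univ,
        gg l (l - t) (dl l + (col l (l - u) + col l s)) (dl l + CC l r s t u) T := by
    intro T T' hne hT hT' h h'
    have hsub : ({T, T'} : Finset (Finset (Fin l))) ⊆ powersetCard r univ := by
      intro x hx
      simp only [Finset.mem_insert, Finset.mem_singleton] at hx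
      rw [Finset.mem_powersetCard]
      rcases hx with rfl | rfl <;> exact ⟨Finset.subset_univ _, by assumption⟩
    have := Finset.sum_le_sum_of_subset_of_nonneg hsub (f := fun T =>
      gg l (l - t) (dl l + (col l (l - u) + col l s)) (dl l + CC l r s t u) T)
      (fun x _ _ => (gg_cases (l - t) (BB_strict l s u) (CC_strict l r s t u) x).1)
    rw [Finset.sum_pair hne] at this
    linarith
  obtain ⟨T, hT, hm, hg⟩ := gg_T1 (l := l) (by omega) hr ht h₅
  rcases Nat.eq_zero_or_pos s with hs | hs
  · obtain ⟨T', hT', hm', hg'⟩ := gg_T3 (l := l) (by omega) hr ht (show 0 < u by omega) h₅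
    refine key T T' (fun h => ?_) hT hT' hg hg'
    subst h
    have h1 := hm' ⟨l - u, by omega⟩
    rw [hm] at h1
    simp only [true_or, iff_true] at h1
    omega
  · obtain ⟨T', hT', hm', hg'⟩ := gg_T2 (l := l) (by omega) hr ht hs h₅
    refine key T T' (fun h => ?_) hT hT' hg hg'
    subst h
    have h1 := hm' ⟨0, by omega⟩
    rw [hm] at h1
    simp only [true_or, iff_true] at h1
    omega

theorem second_le {l r s t u : ℕ} (a : ℕ) (h₅ : r + 1 + s + t + u ≤ l) :
    ∑ T ∈ powersetCard r univ,
      gg l a (dl l + (col l (l - u) + col l s)) (dl l + CC l (r + 1) s t u) T ≤ 1 := by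
  let T0 : Finset (Fin l) := univ.filter (fun i => s ≤ (i : ℕ) ∧ (i : ℕ) < r + s)
  have hm : ∀ i : Fin l, i ∈ T0 ↔ s ≤ (i : ℕ) ∧ (i : ℕ) < r + s := by intro i; simp [T0]
  have hc : T0.card = r := by
    have h : ∑ i, (ind T0 i + col l s i) = ∑ i, col l (r + s) i := by
      refine Finset.sum_congr rfl fun i _ => ?_
      simp only [ind, col, hm]
      split_ifs <;> omega
    rw [Finset.sum_add_distrib, sum_ind, sum_col (by omega), sum_col (by omega)] at h
    omega
  calc _ ≤ ∑ T ∈ powersetCard r (univ : Finset (Fin l)), if T = T0 then (1 : ℤ) else 0 := by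
        refine Finset.sum_le_sum fun T hT => ?_
        obtain ⟨_, h1, h2⟩ := gg_cases a (BB_strict l s u) (CC_strict l (r + 1) s t u) T
        split_ifs with hT0
        · exact h1
        · by_contra hpos
          obtain ⟨S, hS⟩ := h2 (by omega)
          apply hT0
          rw [Finset.mem_powersetCard] at hT
          symm
          apply Finset.eq_of_subset_of_card_le
          · intro i hi
            by_contra hiT
            have hS1 := congrFun hS i
            have hS2 := ind_le S i
            rw [hm] at hi
            have : ind T i = 0 := by simp [ind, hiT]
            simp only [Pi.add_apply, this, CC, col] at hS1
            have := i.2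
            split_ifs at hS1 <;> omega
          · omega
    _ ≤ 1 := by rw [Finset.sum_ite_eq']; split_ifs <;> simp

theorem schurMult_eq (l : ℕ) (A B C : Fin l → ℕ) :
    schurMult l C (schur l A * schur l B) =
      coeff (Finsupp.equivFunOnFinite.symm (dl l + C)) (schur l A * alt l (dl l + B)) := by
  rw [← bialt', schurMult, mul_assoc]
  congr 2
  ext i
  simp [dl, add_comm]

theorem main_pos (l r s t u : ℕ) (h₁ : 0 < r + s) (h₂ : 0 < t + u)
    (h₃ : 0 < r + t) (h₄ : 0 < s + u) (h₅ : r + s + t + u ≤ l) :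
    0 < coeff (Finsupp.equivFunOnFinite.symm (dl l + CC l r s t u))
      (schur l (col l (l - t) + col l r) * alt l (dl l + (col l (l - u) + col l s))) := by
  rcases Nat.eq_zero_or_pos r with hr | hr
  · subst hr
    rw [col_zero, add_zero, schur_one (by omega), coeff_one_e (BB_strict l s u)
      (CC_strict l 0 s t u)]
    obtain ⟨S, hS, hS'⟩ := exS (l := l) (a := l - t)
      (β := dl l + (col l (l - u) + col l s)) (γ := dl l + CC l 0 s t u)
      (by
        intro i
        have := i.2
        simp only [Pi.add_apply, CC, col]
        constructor <;> split_ifs <;> omega)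
      (by
        rw [sum_CC (by omega) h₂ h₅, sum_BB (by omega)]
        omega)
    have := cnt_pos hS hS'
    omega
  rcases Nat.eq_zero_or_pos t with ht | ht
  · subst ht
    have hβ : StrictAnti (dl l + (col l (l - u) + col l s) + fun _ => 1) := by
      intro i j hij
      have := BB_strict l s u hij
      simp only [Pi.add_apply] at this ⊢
      omega
    rw [Nat.sub_zero, schur_full (by omega), mul_assoc, e_full,
      coeff_one_e hβ (CC_strict l r s 0 u)]
    obtain ⟨S, hS, hS'⟩ := exS (l := l) (a := r)
      (β := dl l + (col l (l - u) + col l s) + fun _ => 1) (γ := dl l + CC l r s 0 u)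
      (by
        intro i
        have := i.2
        simp only [Pi.add_apply, CC, col]
        constructor <;> split_ifs <;> omega)
      (by
        have h1 : ∑ i, (dl l + (col l (l - u) + col l s) + fun _ => 1 : Fin l → ℕ) i =
          ∑ i, (dl l + (col l (l - u) + col l s)) i + l := by
          simp only [Pi.add_apply, Finset.sum_add_distrib]
          simp
        rw [sum_CC (by omega) h₂ h₅, h1, sum_BB (by omega)]
        omega)
    have := cnt_pos hS hS'
    omega
  obtain ⟨b, rfl⟩ : ∃ b, r = b + 1 := ⟨r - 1, by omega⟩
  rw [schur_two (by omega) (by omega), sub_mul, coeff_sub, coeff_two_e, coeff_two_e]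
  have hA := first_ge (l := l) hr ht h₄ h₅
  have hB := second_le (l := l) (r := b) (s := s) (t := t) (u := u) (l - t + 1) h₅
  omega

/-- For `l ≥ 1`, `r+s > 0`, `t+u > 0`, `r+t > 0`, `s+u > 0`,
`r+s+t+u ≤ l`, the three-column partition `D(l) + Λ^{r+s-1} + Λ^{l-t-u+1}` has positive
multiplicity in `s_{Λ^r + Λ^{l-t}} · s_{Λ^s + Λ^{l-u}}`. -/
theorem exchange_identity (l r s t u : ℕ) (hl : 1 ≤ l) (h₁ : 0 < r + s) (h₂ : 0 < t + u)
    (h₃ : 0 < r + t) (h₄ : 0 < s + u) (h₅ : r + s + t + u ≤ l) :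
    0 < schurMult l
      (fun i => 1 + (if (i : ℕ) < l - t - u + 1 then 1 else 0) +
        (if (i : ℕ) < r + s - 1 then 1 else 0))
      (schur l (fun i => (if (i : ℕ) < l - t then 1 else 0) +
          (if (i : ℕ) < r then 1 else 0)) *
        schur l (fun i => (if (i : ℕ) < l - u then 1 else 0) +
          (if (i : ℕ) < s then 1 else 0))) := by
  have h := main_pos l r s t u h₁ h₂ h₃ h₄ h₅
  rw [← schurMult_eq] at h
  convert h using 2
  · ext i
    simp [CC, col]
  · rfl
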